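/- Let M = (M^m)_{m≥0} be a mould with M^0 = 0 and M^1 = 0 which is alternal and such that swap(M) + C is alternil for some constant mould C. Then the identity ũ(M)^4(x_2,x_3,x_4,x_1) + coll^4_{1,2}(ũ(M))(x_1,x_2,x_3,x_4) = ũ(M)^4(x_1,x_2,x_3,x_4) + coll^4_{2,3}(ũ(M))(x_1,x_2,x_3,x_4) holds in ℚ(x_1,x_2,x_3,x_4); equivalently, M satisfies Ecalle's senary relation at depth r = 3. -/

import Mathlib

open MvPolynomial
open scoped TensorProduct

open MvPolynomial

/-- A mould: a family `M = (M^m)_{m ≥ 0}` with `M^m ∈ ℚ[x_1,…,x_m]`. -/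
abbrev Mould : Type := (m : ℕ) → MvPolynomial (Fin m) ℚ

/-- Evaluation of the depth-`m` component of a mould at a vector `v`. -/
noncomputable def mEval {K : Type} [CommRing K] (f : ℚ →+* K) (M : Mould) {m : ℕ}
    (v : Fin m → K) : K :=
  MvPolynomial.eval₂ f v (M m)

/-- The rational function field `ℚ(x_1,…,x_n)`. -/
abbrev FF (n : ℕ) : Type := FractionRing (MvPolynomial (Fin n) ℚ)

/-- The variable `x_i` as an element of `ℚ(x_1,…,x_n)`. -/
noncomputable def xv {n : ℕ} (i : Fin n) : FF n :=
  algebraMap (MvPolynomial (Fin n) ℚ) (FF n) (X i)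

/-- Ecalle's senary relation at depth `r = s+1`, as an identity in `ℚ(y_1,…,y_r)`:
`M^r(y_1,…,y_r) + (M^{r-1}(y_1,…,y_{r-2},y_{r-1}+y_r) - M^{r-1}(y_1,…,y_{r-1}))/y_r
 = M^r(-y_1-⋯-y_r, y_1,…,y_{r-1})
   + (M^{r-1}(-y_2-⋯-y_r, y_2,…,y_{r-1}) - M^{r-1}(y_1,…,y_{r-1}))/(y_1+⋯+y_r)`. -/
noncomputable def SenaryAt (M : Mould) (s : ℕ) : Prop :=
  mEval (Rat.castHom (FF (s+1))) M (fun i : Fin (s+1) => xv i)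
    + (mEval (Rat.castHom (FF (s+1))) M (fun i : Fin s =>
          if i.val = s - 1 then xv (⟨s-1, by omega⟩ : Fin (s+1)) + xv (Fin.last s)
          else xv i.castSucc)
       - mEval (Rat.castHom (FF (s+1))) M (fun i : Fin s => xv i.castSucc)) / xv (Fin.last s)
  = mEval (Rat.castHom (FF (s+1))) M (fun i : Fin (s+1) =>
        if i.val = 0 then -(∑ j : Fin (s+1), xv j)
        else xv (⟨i.val - 1, by have := i.isLt; omega⟩ : Fin (s+1)))
    + (mEval (Rat.castHom (FF (s+1))) M (fun i : Fin s =>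
          if i.val = 0 then -(∑ j : Fin s, xv j.succ) else xv i.castSucc)
       - mEval (Rat.castHom (FF (s+1))) M (fun i : Fin s => xv i.castSucc))
      / (∑ j : Fin (s+1), xv j)
/-- Evaluation of `ũ(M)^{m+1}` (where `ũ = t̃ ∘ swap`):
`ũ(M)^{m+1}(v_1,…,v_{m+1}) = M^m(v_{m+1}-v_1, v_m-v_{m+1}, v_{m-1}-v_m, …, v_2-v_3)`. -/
noncomputable def uEval {K : Type} [CommRing K] (f : ℚ →+* K) (M : Mould) {m : ℕ}
    (v : Fin (m+1) → K) : K :=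
  mEval f M (fun j : Fin m =>
    if h : j.val = 0 then v (Fin.last m) - v 0
    else v ⟨m - j.val, by omega⟩ - v ⟨m - j.val + 1, by have := j.isLt; omega⟩)

/-- `coll^{t+2}_{i,i+1}` (with `1`-indexed `i = k+1`) applied to `N = ũ(M)`,
evaluated at `v = (x_1,…,x_{t+2})`:
`(N^{t+1}(x_1,…,x_i,x_{i+2},…) - N^{t+1}(x_1,…,x_{i-1},x_{i+1},x_{i+2},…))/(x_i - x_{i+1})`. -/
noncomputable def collUEval {K : Type} [Field K] (f : ℚ →+* K) (M : Mould) {t : ℕ}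
    (k : Fin (t+1)) (v : Fin (t+2) → K) : K :=
  (uEval f M (fun j : Fin (t+1) => v (Fin.succAbove k.succ j))
    - uEval f M (fun j : Fin (t+1) => v (Fin.succAbove k.castSucc j)))
    / (v k.castSucc - v k.succ)
/-- The swap of a mould: `swap(M)^m(v_1,…,v_m) = M^m(v_m, v_{m-1}-v_m, …, v_1-v_2)`. -/
noncomputable def swapM (M : Mould) : Mould := fun m =>
  MvPolynomial.eval₂ MvPolynomial.C
    (fun i : Fin m =>
      (MvPolynomial.X ⟨m - 1 - i.val, by have := i.isLt; omega⟩ : MvPolynomial (Fin m) ℚ)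
        - (if h : i.val = 0 then 0
           else MvPolynomial.X ⟨m - i.val, by have := i.isLt; omega⟩))
    (M m)

open scoped Classical in
/-- Alternality of a mould: `M^0 = 0` and for all `p, q ≥ 1` the sum of
`M^{p+q}(x_{σ(1)},…,x_{σ(p+q)})` over the `(p,q)`-shuffle permutations vanishes. -/
noncomputable def IsAlternal (M : Mould) : Prop :=
  M 0 = 0 ∧ ∀ p q : ℕ, 1 ≤ p → 1 ≤ q →
    ∑ σ : Equiv.Perm (Fin (p+q)),
      (if ((∀ i j : Fin (p+q), i < j → j.val < p → σ.symm i < σ.symm j) ∧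
           (∀ i j : Fin (p+q), i < j → p ≤ i.val → σ.symm i < σ.symm j))
       then MvPolynomial.eval₂ MvPolynomial.C
              (fun i => (X (σ i) : MvPolynomial (Fin (p+q)) ℚ)) (M (p+q))
       else 0) = 0

/-- The field `ℚ(y_1, y_2, …)` (the variable `X i` stands for `y_{i+1}`). -/
abbrev Kinf : Type := FractionRing (MvPolynomial ℕ ℚ)

noncomputable def yvar (i : ℕ) : Kinf := algebraMap (MvPolynomial ℕ ℚ) Kinf (X i)

/-- A letter: a `ℤ`-linear combination of the letters `x_1, x_2, …`
(the generator `i` stands for `x_{i+1}`). -/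
abbrev Letter : Type := ℕ →₀ ℤ

/-- The value of a letter under `x_i ↦ y_i`. -/
noncomputable def letterVal (l : Letter) : Kinf := l.sum fun i n => (n : Kinf) * yvar i

/-- `f(u) = 1/(n_1 y_{i_1} + ⋯ + n_k y_{i_k})` for `u = n_1 x_{i_1} + ⋯ + n_k x_{i_k} ≠ 0`,
and `f(0) = 0`. -/
noncomputable def collide (l : Letter) : Kinf := (letterVal l)⁻¹

/-- The `ш*` product of two words, as a formal `ℚ(y_1,y_2,…)`-linear combination of words:
`uω ш* vη = u(ω ш* vη) + v(uω ш* η) + f(u-v)·(u(ω ш* η) - v(ω ш* η))`. -/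
noncomputable def shMul : List Letter → List Letter → (List Letter →₀ Kinf)
  | [], η => Finsupp.single η 1
  | ω, [] => Finsupp.single ω 1
  | u :: ω, v :: η =>
      Finsupp.mapDomain (List.cons u) (shMul ω (v :: η))
        + Finsupp.mapDomain (List.cons v) (shMul (u :: ω) η)
        + collide (u - v) • (Finsupp.mapDomain (List.cons u) (shMul ω η)
            - Finsupp.mapDomain (List.cons v) (shMul ω η))
  termination_by ω η => ω.length + η.length

/-- `N^{l(α)}(α)`, evaluated with `y_i := x_i`. -/
noncomputable def wordEval (N : Mould) (α : List Letter) : Kinf :=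
  MvPolynomial.eval₂ (Rat.castHom Kinf) (fun j : Fin α.length => letterVal (α.get j))
    (N α.length)

/-- Alternility of a mould: `N^0 = 0` and for all `p, q ≥ 1`,
`Σ_α ⟨(x_1,…,x_p) ш* (x_{p+1},…,x_{p+q}) | α⟩|_{y_i := x_i} · N^{l(α)}(α) = 0`. -/
noncomputable def IsAlternil (N : Mould) : Prop :=
  N 0 = 0 ∧ ∀ p q : ℕ, 1 ≤ p → 1 ≤ q →
    (shMul ((List.range p).map fun j => Finsupp.single j 1)
           ((List.range q).map fun j => Finsupp.single (p + j) 1)).sum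
      (fun α c => c * wordEval N α) = 0

/-- Functional form of the senary relation at depth three: `A` and `B` play the roles of the
depth-three and depth-two components of the mould. -/
theorem senary_of_shuffle_relations {K : Type} [Field K] (A : K → K → K → K) (B : K → K → K)
    (k : K) (hA : ∀ x y z, A x y z + A y x z + A y z x = 0)
    (hB : ∀ x y, B x y = -B y x) (hT : ∀ x y, B x y = -B (x + y) (-y))
    (hS : ∀ x y z, x ≠ y → x ≠ z →
      A z (y - z) (x - y) + A z (x - z) (y - x) + A x (z - x) (y - z) + 3 * k
        + (x - y)⁻¹ * (B z (x - z) - B z (y - z))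
        + (x - z)⁻¹ * (B x (y - x) - B z (y - z)) = 0)
    {a b c : K} (hb : b ≠ 0) (hc : c ≠ 0) (hbc : b + c ≠ 0) (hac : a + c ≠ 0)
    (habc : a + b + c ≠ 0) :
    A a b c + (B a (b + c) - B a b) / c
      = A (-(a + b + c)) a b + (B (-(b + c)) b - B a b) / (a + b + c) := by
  have hS' : ∀ x y z p q r t w, y - z = p → x - y = q → x - z = r → y - x = t → z - x = w →
      q ≠ 0 → r ≠ 0 →
      A z p q + A z r t + A x w p + 3 * k + q⁻¹ * (B z r - B z p) + r⁻¹ * (B x t - B z p)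
        = 0 := by
    rintro x y z _ _ _ _ _ rfl rfl rfl rfl rfl hq hr
    exact hS x y z (sub_ne_zero.1 hq) (sub_ne_zero.1 hr)
  have h1 := hS' a (a + b + c) (a + b) c (-(b + c)) (-b) (b + c) b
    (by ring) (by ring) (by ring) (by ring) (by ring) (neg_ne_zero.2 hbc) (neg_ne_zero.2 hb)
  have h2 := hS' a (-c) (a + b) (-(a + b + c)) (a + c) (-b) (-(a + c)) b
    (by ring) (by ring) (by ring) (by ring) (by ring) hac (neg_ne_zero.2 hb)
  have h3 := hS' (-c) a (a + b) (-b) (-(a + c)) (-(a + b + c)) (a + c) (a + b + c)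
    (by ring) (by ring) (by ring) (by ring) (by ring) (neg_ne_zero.2 hac) (neg_ne_zero.2 habc)
  have h4 := hS' (a + b + c) a (a + b) (-b) (b + c) c (-(b + c)) (-c)
    (by ring) (by ring) (by ring) (by ring) (by ring) hbc hc
  have h5 := hS' (-c) a (-(b + c)) (a + b + c) (-(a + c)) b (a + c) (-b)
    (by ring) (by ring) (by ring) (by ring) (by ring) (neg_ne_zero.2 hac) hb
  have h6 := hA (a + b + c) (-c) (-b)
  have h7 := hS' a (-c) (-(b + c)) b (a + c) (a + b + c) (-(a + c)) (-(a + b + c))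
    (by ring) (by ring) (by ring) (by ring) (by ring) hac habc
  have h8 := hA (-(a + b + c)) a b
  have e1 : B (a + b) (-(a + b + c)) = -B (a + b) c := by
    rw [hT (a + b) c, hB (a + b + c), hT (a + b), neg_neg, neg_neg]
    congr 2
    ring
  have e2 : B (-c) (a + c) = -B a (-(a + c)) := by
    rw [hT (-c), show -c + (a + c) = a by ring]
  have e3 : B (a + b + c) (-(b + c)) = -B a (b + c) := by
    rw [hT a, neg_neg, add_assoc]
  have e4 : B (-(b + c)) (a + b + c) = B a (b + c) := by
    rw [hB, e3, neg_neg]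
  have e5 : B a b = -B (a + b) (-b) := hT a b
  rw [e1] at h2 h3
  rw [e2] at h3 h5
  rw [e3] at h4
  rw [e4] at h5 h7
  rw [e5]
  simp only [inv_neg] at h1 h2 h3 h4 h5 h7
  rw [div_eq_mul_inv, div_eq_mul_inv]
  linear_combination h1 + h2 - h3 - h4 - h5 + h6 + h7 - h8

theorem map_mEval {K L : Type} [CommRing K] [CommRing L] (φ : K →+* L) (f : ℚ →+* K) (M : Mould)
    {m : ℕ} (v : Fin m → K) : φ (mEval f M v) = mEval (φ.comp f) M (fun i => φ (v i)) :=
  hom_eval₂ _ _ _ _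

theorem mEval_swapM_add_two {K : Type} [CommRing K] (f : ℚ →+* K) (M : Mould) (c : ℕ → ℚ)
    (x y : K) :
    mEval f (fun m => swapM M m + C (c m)) ![x, y] = mEval f M ![y, x - y] + f (c 2) := by
  unfold mEval swapM
  rw [eval₂_add, eval₂_C]
  congr 1
  rw [← coe_eval₂Hom, hom_eval₂]
  congr 1
  · exact Subsingleton.elim _ _
  · funext i
    fin_cases i <;> simp

theorem mEval_swapM_add_three {K : Type} [CommRing K] (f : ℚ →+* K) (M : Mould) (c : ℕ → ℚ)
    (x y z : K) :
    mEval f (fun m => swapM M m + C (c m)) ![x, y, z]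
      = mEval f M ![z, y - z, x - y] + f (c 3) := by
  unfold mEval swapM
  rw [eval₂_add, eval₂_C]
  congr 1
  rw [← coe_eval₂Hom, hom_eval₂]
  congr 1
  · exact Subsingleton.elim _ _
  · funext i
    fin_cases i <;> simp

theorem IsAlternal.two {M : Mould} (h : IsAlternal M) {K : Type} [CommRing K] (f : ℚ →+* K)
    (x y : K) : mEval f M ![x, y] + mEval f M ![y, x] = 0 := by
  have h' := congrArg (eval₂Hom f ![x, y]) (h.2 1 1 le_rfl le_rfl)
  rw [← Finset.sum_filter] at h'
  have hs : ∀ s : Finset (Equiv.Perm (Fin (1 + 1))),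
      (∀ σ, σ ∈ s ↔ (∀ i j : Fin (1 + 1), i < j → j.val < 1 → σ.symm i < σ.symm j) ∧
        (∀ i j : Fin (1 + 1), i < j → 1 ≤ i.val → σ.symm i < σ.symm j)) →
      s = {1, Equiv.swap 0 1} := by
    intro s hs
    ext σ
    rw [hs]
    revert σ
    decide
  rw [hs (Finset.univ.filter _) (fun σ => by simp),
    Finset.sum_insert (by decide), Finset.sum_singleton, map_add,
    map_zero, hom_eval₂, hom_eval₂] at h'
  rw [← h']
  unfold mEval
  congr 2
  · exact Subsingleton.elim _ _
  · funext i
    fin_cases i <;> simp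
  · exact Subsingleton.elim _ _
  · funext i
    fin_cases i <;> simp

theorem IsAlternal.three {M : Mould} (h : IsAlternal M) {K : Type} [CommRing K] (f : ℚ →+* K)
    (x y z : K) :
    mEval f M ![x, y, z] + mEval f M ![y, x, z] + mEval f M ![y, z, x] = 0 := by
  have h' := congrArg (eval₂Hom f ![x, y, z]) (h.2 1 2 le_rfl one_le_two)
  rw [← Finset.sum_filter] at h'
  have hs : ∀ s : Finset (Equiv.Perm (Fin (1 + 2))),
      (∀ σ, σ ∈ s ↔ (∀ i j : Fin (1 + 2), i < j → j.val < 1 → σ.symm i < σ.symm j) ∧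
        (∀ i j : Fin (1 + 2), i < j → 1 ≤ i.val → σ.symm i < σ.symm j)) →
      s = {1, Equiv.swap 0 1, finRotate 3} := by
    intro s hs
    ext σ
    rw [hs]
    revert σ
    decide
  rw [hs (Finset.univ.filter _) (fun σ => by simp),
    Finset.sum_insert (by decide), Finset.sum_insert (by decide),
    Finset.sum_singleton, map_add, map_add, map_zero, hom_eval₂, hom_eval₂, hom_eval₂,
    ← add_assoc] at h'
  rw [← h']
  have hv (σ : Equiv.Perm (Fin 3)) (v : Fin 3 → K) (e : v = ![x, y, z] ∘ σ) :
      mEval f M v = eval₂ ((eval₂Hom f ![x, y, z]).comp C)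
        (fun i => eval₂Hom f ![x, y, z] (X (σ i))) (M 3) := by
    subst e
    refine congrArg₂ (fun f v => eval₂ f v (M 3)) (Subsingleton.elim _ _) ?_
    funext k
    simp
  refine congrArg₂ (· + ·) (congrArg₂ (· + ·) (hv _ _ ?_) (hv _ _ ?_)) (hv _ _ ?_) <;>
  · funext k
    fin_cases k <;> rfl

theorem letterVal_single (i : ℕ) : letterVal (Finsupp.single i 1) = yvar i := by
  simp [letterVal]

theorem collide_single_sub (i j : ℕ) :
    collide (Finsupp.single i 1 - Finsupp.single j 1) = (yvar i - yvar j)⁻¹ := by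
  unfold collide letterVal
  rw [Finsupp.sum_sub_index (by intros; push_cast; ring)]
  simp

theorem wordEval_pair (N : Mould) (i j : ℕ) :
    wordEval N [Finsupp.single i 1, Finsupp.single j 1]
      = mEval (Rat.castHom Kinf) N ![yvar i, yvar j] := by
  unfold wordEval mEval
  congr 1
  funext k
  change Fin 2 at k
  fin_cases k <;> exact letterVal_single _

theorem wordEval_triple (N : Mould) (i j l : ℕ) :
    wordEval N [Finsupp.single i 1, Finsupp.single j 1, Finsupp.single l 1]
      = mEval (Rat.castHom Kinf) N ![yvar i, yvar j, yvar l] := by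
  unfold wordEval mEval
  congr 1
  funext k
  change Fin 3 at k
  fin_cases k <;> exact letterVal_single _

theorem linearCombination_shMul_nil_left (g : List Letter → Kinf) (η : List Letter) :
    Finsupp.linearCombination Kinf g (shMul [] η) = g η := by
  simp [shMul]

theorem linearCombination_shMul_nil_right (g : List Letter → Kinf) (ω : List Letter) :
    Finsupp.linearCombination Kinf g (shMul ω []) = g ω := by
  cases ω <;> simp [shMul]

theorem linearCombination_shMul_cons (g : List Letter → Kinf) (u v : Letter)
    (ω η : List Letter) :
    Finsupp.linearCombination Kinf g (shMul (u :: ω) (v :: η))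
      = Finsupp.linearCombination Kinf (g ∘ List.cons u) (shMul ω (v :: η))
        + Finsupp.linearCombination Kinf (g ∘ List.cons v) (shMul (u :: ω) η)
        + collide (u - v) * (Finsupp.linearCombination Kinf (g ∘ List.cons u) (shMul ω η)
          - Finsupp.linearCombination Kinf (g ∘ List.cons v) (shMul ω η)) := by
  rw [shMul]
  simp only [map_add, map_sub, map_smul, Finsupp.linearCombination_mapDomain, smul_eq_mul]

theorem yvar_sub_ne_zero {i j : ℕ} (h : i ≠ j) : yvar i - yvar j ≠ 0 := by
  rw [sub_ne_zero]
  intro e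
  exact h (X_injective (IsFractionRing.injective (MvPolynomial ℕ ℚ) Kinf e))

theorem mEval_yvar_pair (N : Mould) (i j : ℕ) :
    mEval (Rat.castHom Kinf) N ![yvar i, yvar j]
      = algebraMap (MvPolynomial ℕ ℚ) Kinf (mEval C N ![X i, X j]) := by
  rw [map_mEval]
  refine congrArg₂ (fun f v => mEval f N v) (Subsingleton.elim _ _) ?_
  funext k
  fin_cases k <;> rfl

theorem mEval_yvar_triple (N : Mould) (i j l : ℕ) :
    mEval (Rat.castHom Kinf) N ![yvar i, yvar j, yvar l]
      = algebraMap (MvPolynomial ℕ ℚ) Kinf (mEval C N ![X i, X j, X l]) := by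
  rw [map_mEval]
  refine congrArg₂ (fun f v => mEval f N v) (Subsingleton.elim _ _) ?_
  funext k
  fin_cases k <;> rfl

theorem map_mEval_X_pair {K : Type} [CommRing K] (f : ℚ →+* K) (v : ℕ → K) (N : Mould) (i j : ℕ) :
    eval₂Hom f v (mEval C N ![X i, X j]) = mEval f N ![v i, v j] := by
  rw [map_mEval]
  refine congrArg₂ (fun f v => mEval f N v) (Subsingleton.elim _ _) ?_
  funext k
  fin_cases k <;> simp

theorem map_mEval_X_triple {K : Type} [CommRing K] (f : ℚ →+* K) (v : ℕ → K) (N : Mould)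
    (i j l : ℕ) :
    eval₂Hom f v (mEval C N ![X i, X j, X l]) = mEval f N ![v i, v j, v l] := by
  rw [map_mEval]
  refine congrArg₂ (fun f v => mEval f N v) (Subsingleton.elim _ _) ?_
  funext k
  fin_cases k <;> simp

theorem IsAlternil.two {N : Mould} (h : IsAlternil N)
    (hN : ∀ l l' : Letter, wordEval N [l] = wordEval N [l']) {K : Type} [CommRing K]
    (f : ℚ →+* K) (x y : K) : mEval f N ![x, y] + mEval f N ![y, x] = 0 := by
  have h' : Finsupp.linearCombination Kinf (wordEval N)
      (shMul [Finsupp.single 0 1] [Finsupp.single 1 1]) = 0 := h.2 1 1 le_rfl le_rfl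
  simp only [linearCombination_shMul_cons, linearCombination_shMul_nil_left,
    linearCombination_shMul_nil_right, Function.comp_apply, wordEval_pair] at h'
  rw [hN (Finsupp.single 0 1) (Finsupp.single 1 1), sub_self, mul_zero, add_zero,
    mEval_yvar_pair, mEval_yvar_pair, ← map_add] at h'
  have hp := congrArg (eval₂Hom f (fun i => if i = 0 then x else y))
    ((map_eq_zero_iff _ (IsFractionRing.injective (MvPolynomial ℕ ℚ) Kinf)).1 h')
  rw [map_add, map_zero, map_mEval_X_pair, map_mEval_X_pair] at hp
  simpa using hp

theorem IsAlternil.three {N : Mould} (h : IsAlternil N) {K : Type} [Field K] (f : ℚ →+* K)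
    {x y z : K} (hxy : x ≠ y) (hxz : x ≠ z) :
    mEval f N ![x, y, z] + mEval f N ![y, x, z] + mEval f N ![y, z, x]
      + (x - y)⁻¹ * (mEval f N ![x, z] - mEval f N ![y, z])
      + (x - z)⁻¹ * (mEval f N ![y, x] - mEval f N ![y, z]) = 0 := by
  have h' : Finsupp.linearCombination Kinf (wordEval N)
      (shMul [Finsupp.single 0 1] [Finsupp.single 1 1, Finsupp.single 2 1]) = 0 :=
    h.2 1 2 le_rfl one_le_two
  simp only [linearCombination_shMul_cons, linearCombination_shMul_nil_left,
    linearCombination_shMul_nil_right, Function.comp_apply, wordEval_pair, wordEval_triple,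
    collide_single_sub] at h'
  have h01 : yvar 0 - yvar 1 ≠ 0 := yvar_sub_ne_zero zero_ne_one
  have h02 : yvar 0 - yvar 2 ≠ 0 := yvar_sub_ne_zero (by decide)
  field_simp at h'
  rw [mul_zero] at h'
  simp only [mEval_yvar_pair, mEval_yvar_triple] at h'
  simp only [yvar, ← map_add, ← map_sub, ← map_mul] at h'
  have hp := congrArg (eval₂Hom f (fun i => if i = 0 then x else if i = 1 then y else z))
    ((map_eq_zero_iff _ (IsFractionRing.injective (MvPolynomial ℕ ℚ) Kinf)).1 h')
  simp only [map_add, map_sub, map_mul, map_zero, map_mEval_X_pair, map_mEval_X_triple,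
    coe_eval₂Hom, eval₂_X, if_pos, one_ne_zero, if_false, OfNat.ofNat_ne_zero,
    OfNat.ofNat_ne_one] at hp
  have hxy' := sub_ne_zero.2 hxy
  have hxz' := sub_ne_zero.2 hxz
  field_simp
  linear_combination hp

/-- The senary relation at depth three, evaluated at a point of a field where the relevant linear
forms do not vanish. -/
theorem mEval_senary_three {M : Mould} (h1 : M 1 = 0) (hal : IsAlternal M) {c : ℕ → ℚ}
    (hil : IsAlternil (fun m => swapM M m + C (c m))) {K : Type} [Field K] (f : ℚ →+* K)
    {x y z : K} (hy : y ≠ 0) (hz : z ≠ 0) (hyz : y + z ≠ 0) (hxz : x + z ≠ 0)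
    (hxyz : x + y + z ≠ 0) :
    mEval f M ![x, y, z] + (mEval f M ![x, y + z] - mEval f M ![x, y]) / z
      = mEval f M ![-(x + y + z), x, y]
        + (mEval f M ![-(y + z), y] - mEval f M ![x, y]) / (x + y + z) := by
  have hN (l l' : Letter) : wordEval (fun m => swapM M m + C (c m)) [l]
      = wordEval (fun m => swapM M m + C (c m)) [l'] := by
    simp [wordEval, swapM, h1]
  have hc : c 2 = 0 := by
    have e := hil.two hN (RingHom.id ℚ) 0 0
    rw [mEval_swapM_add_two, sub_zero] at e
    have e' := hal.two (RingHom.id ℚ) 0 0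
    rw [RingHom.id_apply] at e
    linarith
  refine senary_of_shuffle_relations (fun x y z => mEval f M ![x, y, z])
    (fun x y => mEval f M ![x, y]) (f (c 3)) (hal.three f)
    (fun x y => eq_neg_of_add_eq_zero_left (hal.two f x y)) (fun x y => ?_)
    (fun x y z hxy hxz => ?_) hy hz hyz hxz hxyz
  · have e := hil.two hN f (x + y) x
    rw [mEval_swapM_add_two, mEval_swapM_add_two, hc, map_zero, add_zero, add_zero,
      add_sub_cancel_left, sub_add_cancel_left] at e
    exact eq_neg_of_add_eq_zero_left e
  · have e := hil.three f hxy hxz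
    simp only [mEval_swapM_add_two, mEval_swapM_add_three] at e
    linear_combination e

theorem uEval_three {K : Type} [CommRing K] (f : ℚ →+* K) (M : Mould) (v : Fin 3 → K) :
    uEval f M v = mEval f M ![v 2 - v 0, v 1 - v 2] := by
  unfold uEval
  congr 1
  funext k
  fin_cases k <;> rfl

theorem uEval_four {K : Type} [CommRing K] (f : ℚ →+* K) (M : Mould) (v : Fin 4 → K) :
    uEval f M v = mEval f M ![v 3 - v 0, v 2 - v 3, v 1 - v 2] := by
  unfold uEval
  congr 1
  funext k
  fin_cases k <;> rfl

theorem algebraMap_ne_zero_of_eval {n : ℕ} (p : MvPolynomial (Fin n) ℚ) (v : Fin n → ℚ)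
    (h : eval v p ≠ 0) : algebraMap (MvPolynomial (Fin n) ℚ) (FF n) p ≠ 0 := by
  rw [Ne, map_eq_zero_iff _ (IsFractionRing.injective _ _)]
  rintro rfl
  exact h (map_zero _)

set_option maxHeartbeats 1000000 in
/-- Let `M` be an alternal mould with `M^0 = 0`, `M^1 = 0` such that
`swap(M) + C` is alternil for some constant mould `C`.  Then
`ũ(M)^4(x_2,x_3,x_4,x_1) + coll^4_{1,2}(ũ(M))(x_1,x_2,x_3,x_4)
 = ũ(M)^4(x_1,x_2,x_3,x_4) + coll^4_{2,3}(ũ(M))(x_1,x_2,x_3,x_4)`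
in `ℚ(x_1,x_2,x_3,x_4)`; equivalently, `M` satisfies Ecalle's senary relation at
depth `r = 3`. -/
theorem senary_depth_three (M : Mould) (h0 : M 0 = 0) (h1 : M 1 = 0)
    (hal : IsAlternal M)
    (hil : ∃ c : ℕ → ℚ, IsAlternil (fun m => swapM M m + MvPolynomial.C (c m))) :
    (uEval (Rat.castHom (FF 4)) M ![xv 1, xv 2, xv 3, xv 0]
        + collUEval (Rat.castHom (FF 4)) M 0 ![xv 0, xv 1, xv 2, xv 3]
      = uEval (Rat.castHom (FF 4)) M ![xv 0, xv 1, xv 2, xv 3]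
        + collUEval (Rat.castHom (FF 4)) M 1 ![xv 0, xv 1, xv 2, xv 3]) ∧
    SenaryAt M 2 := by
  obtain ⟨c, hil⟩ := hil
  constructor
  · have key := mEval_senary_three h1 hal hil (Rat.castHom (FF 4))
      (x := xv 3 - xv 0) (y := xv 2 - xv 3) (z := xv 1 - xv 2) ?_ ?_ ?_ ?_ ?_
    · simp only [collUEval, uEval_three, uEval_four]
      change mEval _ M ![xv 0 - xv 1, xv 3 - xv 0, xv 2 - xv 3]
          + (mEval _ M ![xv 3 - xv 0, xv 2 - xv 3] - mEval _ M ![xv 3 - xv 1, xv 2 - xv 3])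
            / (xv 0 - xv 1)
        = mEval _ M ![xv 3 - xv 0, xv 2 - xv 3, xv 1 - xv 2]
          + (mEval _ M ![xv 3 - xv 0, xv 1 - xv 3] - mEval _ M ![xv 3 - xv 0, xv 2 - xv 3])
            / (xv 1 - xv 2)
      have e1 : (xv 3 - xv 0 + (xv 2 - xv 3) + (xv 1 - xv 2) : FF 4) = -(xv 0 - xv 1) := by ring
      have e2 : (xv 2 - xv 3 + (xv 1 - xv 2) : FF 4) = xv 1 - xv 3 := by ring
      rw [e1, e2, neg_neg, neg_sub, div_neg] at key
      linear_combination -key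
    all_goals simp only [xv, ← map_add, ← map_sub]
    all_goals exact algebraMap_ne_zero_of_eval _ ![0, 1, 3, 7] (by simp; try norm_num)
  · have key := mEval_senary_three h1 hal hil (Rat.castHom (FF 3))
      (x := xv 0) (y := xv 1) (z := xv 2) ?_ ?_ ?_ ?_ ?_
    · unfold SenaryAt
      have hs : ∑ j : Fin (2 + 1), xv j = xv 0 + xv 1 + xv 2 := Fin.sum_univ_three _
      simp only [hs, Fin.sum_univ_two]
      refine (congrArg₂ (· + ·) ?_ (congrArg₂ (· / ·) (congrArg₂ (· - ·) ?_ ?_) rfl)).trans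
        (key.trans
          (congrArg₂ (· + ·) ?_ (congrArg₂ (· / ·) (congrArg₂ (· - ·) ?_ ?_) rfl)).symm) <;>
      · refine congrArg (mEval _ M) ?_
        funext k
        fin_cases k <;> rfl
    all_goals simp only [xv, ← map_add]
    all_goals exact algebraMap_ne_zero_of_eval _ ![1, 2, 4] (by simp; try norm_num)
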